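/- Let (μ_n) be a sequence of nonnegative finite Borel measures on ℝ³ with sup_n μ_n(ℝ³) < ∞, converging vaguely to a nonnegative finite Borel measure μ, i.e. ∫_{ℝ³} f dμ_n → ∫_{ℝ³} f dμ for every continuous f : ℝ³ → ℝ vanishing at infinity. Then V_{μ_n} → V_μ in L²_loc(ℝ³): for every R > 0, ∫_{B_R(0)} |V_{μ_n}(x) − V_μ(x)|² dx → 0 as n → ∞. -/

import Mathlib

open MeasureTheory Real Filter

/-- The Coulomb potential generated by a measure `μ` on `ℝ³` (real-valued:
`0` where the defining extended-real integral is infinite, which happens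
only on a null set for finite `μ`). -/
noncomputable def coulomb (μ : Measure (EuclideanSpace ℝ (Fin 3)))
    (x : EuclideanSpace ℝ (Fin 3)) : ℝ :=
  (∫⁻ y, ENNReal.ofReal ‖x - y‖⁻¹ ∂μ).toReal

open scoped ENNReal Topology

/-- A continuous truncation of `t⁻¹` on `[0, ∞)`, vanishing at `0` and equal to `t⁻¹`
for `t ≥ δ`. -/
noncomputable def softInv (δ t : ℝ) : ℝ := t / max t δ ^ 2

theorem continuous_softInv {δ : ℝ} (hδ : 0 < δ) : Continuous (softInv δ) := by
  unfold softInv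
  refine continuous_id.div (by fun_prop) fun t => ?_
  have : 0 < max t δ := lt_max_of_lt_right hδ
  positivity

theorem softInv_nonneg {δ t : ℝ} (ht : 0 ≤ t) : 0 ≤ softInv δ t := by
  unfold softInv
  positivity

theorem softInv_eq_inv {δ t : ℝ} (h : δ ≤ t) : softInv δ t = t⁻¹ := by
  rw [softInv, max_eq_left h]
  rcases eq_or_ne t 0 with rfl | ht
  · simp
  · field_simp

theorem softInv_le_inv {δ t : ℝ} (ht : 0 ≤ t) : softInv δ t ≤ t⁻¹ := by
  rcases ht.eq_or_lt with rfl | ht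
  · simp [softInv]
  have h : t ≤ max t δ := le_max_left _ _
  calc softInv δ t ≤ t / t ^ 2 := by unfold softInv; gcongr
    _ = t⁻¹ := by field_simp

theorem softInv_le {δ : ℝ} (hδ : 0 < δ) (t : ℝ) : softInv δ t ≤ δ⁻¹ := by
  have h : 0 < max t δ := lt_max_of_lt_right hδ
  calc softInv δ t ≤ max t δ / max t δ ^ 2 := by
        unfold softInv; gcongr; exact le_max_left _ _
    _ = (max t δ)⁻¹ := by field_simp
    _ ≤ δ⁻¹ := by gcongr; exact le_max_right _ _

theorem tendsto_softInv_atTop (δ : ℝ) : Tendsto (softInv δ) atTop (𝓝 0) :=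
  tendsto_inv_atTop_zero.congr' <| by
    filter_upwards [eventually_ge_atTop δ] with t ht using (softInv_eq_inv ht).symm

theorem sq_lintegral_le_measure_univ_mul {α : Type*} [MeasurableSpace α] (ν : Measure α)
    {f : α → ℝ≥0∞} (hf : AEMeasurable f ν) :
    (∫⁻ a, f a ∂ν) ^ 2 ≤ ν Set.univ * ∫⁻ a, f a ^ 2 ∂ν := by
  have h := ENNReal.lintegral_mul_le_Lp_mul_Lq ν Real.HolderConjugate.two_two hf
    (aemeasurable_const (b := (1 : ℝ≥0∞)))
  simp only [Pi.mul_apply, mul_one, ENNReal.rpow_two, one_pow, lintegral_const, one_mul] at h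
  calc (∫⁻ a, f a ∂ν) ^ 2
      ≤ ((∫⁻ a, f a ^ 2 ∂ν) ^ (1 / 2 : ℝ) * ν Set.univ ^ (1 / 2 : ℝ)) ^ 2 := by gcongr
    _ = ν Set.univ * ∫⁻ a, f a ^ 2 ∂ν := by
      rw [mul_pow, ← ENNReal.rpow_two, ← ENNReal.rpow_two, ← ENNReal.rpow_mul,
        ← ENNReal.rpow_mul]
      norm_num [mul_comm]

/-- The part of the Coulomb potential lost when `‖x - y‖⁻¹` is replaced by its truncation. -/
noncomputable def nearPotential (ν : Measure (EuclideanSpace ℝ (Fin 3))) (δ : ℝ)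
    (x : EuclideanSpace ℝ (Fin 3)) : ℝ≥0∞ :=
  ∫⁻ y, ENNReal.ofReal (‖x - y‖⁻¹ - softInv δ ‖x - y‖) ∂ν

theorem measurable_coulomb (ν : Measure (EuclideanSpace ℝ (Fin 3))) [SFinite ν] :
    Measurable (coulomb ν) := by
  unfold coulomb
  exact (Measurable.lintegral_prod_right' (f := fun p : EuclideanSpace ℝ (Fin 3) ×
    EuclideanSpace ℝ (Fin 3) => ENNReal.ofReal ‖p.1 - p.2‖⁻¹) (by fun_prop)).ennreal_toReal

theorem measurable_nearKernel {δ : ℝ} (hδ : 0 < δ) :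
    Measurable fun p : EuclideanSpace ℝ (Fin 3) × EuclideanSpace ℝ (Fin 3) =>
      ENNReal.ofReal (‖p.1 - p.2‖⁻¹ - softInv δ ‖p.1 - p.2‖) := by
  have := (continuous_softInv hδ).measurable
  fun_prop

theorem measurable_nearPotential (ν : Measure (EuclideanSpace ℝ (Fin 3))) [SFinite ν] {δ : ℝ}
    (hδ : 0 < δ) : Measurable (nearPotential ν δ) :=
  (measurable_nearKernel hδ).lintegral_prod_right'

theorem lintegral_nearPotential_sq_le (ν : Measure (EuclideanSpace ℝ (Fin 3))) [SFinite ν]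
    {δ : ℝ} (hδ : 0 < δ) :
    ∫⁻ x, nearPotential ν δ x ^ 2 ≤
      ν Set.univ ^ 2 * ∫⁻ z in Metric.ball (0 : EuclideanSpace ℝ (Fin 3)) δ,
        ENNReal.ofReal (‖z‖⁻¹ ^ 2) := by
  set g : EuclideanSpace ℝ (Fin 3) → ℝ≥0∞ :=
    fun z => ENNReal.ofReal (‖z‖⁻¹ - softInv δ ‖z‖) ^ 2 with hg
  have hker := measurable_nearKernel hδ
  have hg_le : ∫⁻ z, g z ≤ ∫⁻ z in Metric.ball (0 : EuclideanSpace ℝ (Fin 3)) δ,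
      ENNReal.ofReal (‖z‖⁻¹ ^ 2) := by
    rw [← lintegral_indicator measurableSet_ball]
    refine lintegral_mono fun z => ?_
    by_cases hz : ‖z‖ < δ
    · rw [Set.indicator_of_mem (by simpa using hz), ENNReal.ofReal_pow (by positivity)]
      exact pow_le_pow_left' (ENNReal.ofReal_le_ofReal
        (sub_le_self _ (softInv_nonneg (norm_nonneg z)))) 2
    · rw [Set.indicator_of_notMem (by simpa using hz)]
      simp [hg, softInv_eq_inv (not_lt.mp hz)]
  calc ∫⁻ x, nearPotential ν δ x ^ 2
      ≤ ∫⁻ x, ν Set.univ * ∫⁻ y, g (x - y) ∂ν := lintegral_mono fun x =>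
        sq_lintegral_le_measure_univ_mul ν (hker.comp measurable_prodMk_left).aemeasurable
    _ = ν Set.univ * ∫⁻ x, ∫⁻ y, g (x - y) ∂ν :=
        lintegral_const_mul _ (hker.pow_const 2).lintegral_prod_right'
    _ = ν Set.univ * ∫⁻ y, (∫⁻ x, g (x - y)) ∂ν := by
        rw [lintegral_lintegral_swap (hker.pow_const 2).aemeasurable]
    _ = ν Set.univ ^ 2 * ∫⁻ z, g z := by
        simp_rw [lintegral_sub_right_eq_self g]
        rw [lintegral_const]
        ring
    _ ≤ _ := by gcongr

theorem lintegral_ball_inv_norm_sq_ne_top :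
    ∫⁻ z in Metric.ball (0 : EuclideanSpace ℝ (Fin 3)) 1, ENNReal.ofReal (‖z‖⁻¹ ^ 2) ≠ ∞ := by
  have h : IntegrableOn (fun z : EuclideanSpace ℝ (Fin 3) => ‖z‖⁻¹ ^ 2)
      (Metric.ball 0 1) volume := by
    refine (integrableOn_fun_norm_addHaar volume (f := fun t : ℝ => t⁻¹ ^ 2)).mpr ?_
    refine (integrableOn_const (C := (1 : ℝ)) (by simp)).congr_fun (fun t ht => ?_)
      measurableSet_Ioo
    have := ht.1.ne'
    simp [this]
  exact h.lintegral_lt_top.ne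

theorem tendsto_lintegral_ball_inv_norm_sq :
    Tendsto (fun δ : ℝ => ∫⁻ z in Metric.ball (0 : EuclideanSpace ℝ (Fin 3)) δ,
      ENNReal.ofReal (‖z‖⁻¹ ^ 2)) (𝓝[>] 0) (𝓝 0) := by
  have hvol : Tendsto (fun δ : ℝ => volume (Metric.ball (0 : EuclideanSpace ℝ (Fin 3)) δ))
      (𝓝[>] 0) (𝓝 0) := by
    have h : Tendsto (fun δ : ℝ => ENNReal.ofReal (δ ^ 3) *
        volume (Metric.ball (0 : EuclideanSpace ℝ (Fin 3)) 1)) (𝓝[>] 0) (𝓝 0) := by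
      have h0 : Tendsto (fun δ : ℝ => ENNReal.ofReal (δ ^ 3)) (𝓝[>] 0) (𝓝 0) := by
        have : Continuous fun δ : ℝ => ENNReal.ofReal (δ ^ 3) :=
          ENNReal.continuous_ofReal.comp (continuous_pow 3)
        simpa using (this.tendsto 0).mono_left nhdsWithin_le_nhds
      simpa only [zero_mul] using ENNReal.Tendsto.mul_const h0 (Or.inr measure_ball_lt_top.ne)
    refine h.congr' ?_
    filter_upwards [self_mem_nhdsWithin] with δ hδ
    rw [Measure.addHaar_ball volume 0 (le_of_lt hδ)]
    simp
  have hvol' : Tendsto (volume.restrict (Metric.ball (0 : EuclideanSpace ℝ (Fin 3)) 1) ∘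
      Metric.ball 0) (𝓝[>] (0 : ℝ)) (𝓝 0) :=
    tendsto_of_tendsto_of_tendsto_of_le_of_le tendsto_const_nhds hvol (fun _ => zero_le)
      fun _ => Measure.restrict_apply_le _ _
  refine (tendsto_setLIntegral_zero lintegral_ball_inv_norm_sq_ne_top hvol').congr' ?_
  filter_upwards [Ioo_mem_nhdsGT one_pos] with δ hδ
  rw [Measure.restrict_restrict measurableSet_ball,
    Set.inter_eq_left.mpr (Metric.ball_subset_ball hδ.2.le)]

theorem integrable_softInv_norm_sub (ν : Measure (EuclideanSpace ℝ (Fin 3)))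
    [IsFiniteMeasure ν] {δ : ℝ} (hδ : 0 < δ) (x : EuclideanSpace ℝ (Fin 3)) :
    Integrable (fun y => softInv δ ‖x - y‖) ν := by
  have := continuous_softInv hδ
  refine Integrable.of_bound (C := δ⁻¹) (by fun_prop) (.of_forall fun y => ?_)
  rw [Real.norm_of_nonneg (softInv_nonneg (norm_nonneg _))]
  exact softInv_le hδ _

theorem coulomb_eq_add_nearPotential (ν : Measure (EuclideanSpace ℝ (Fin 3)))
    [IsFiniteMeasure ν] {δ : ℝ} (hδ : 0 < δ) {x : EuclideanSpace ℝ (Fin 3)}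
    (hx : nearPotential ν δ x ≠ ∞) :
    coulomb ν x = ∫ y, softInv δ ‖x - y‖ ∂ν + (nearPotential ν δ x).toReal := by
  have hint := integrable_softInv_norm_sub ν hδ x
  have hnn : ∀ y, 0 ≤ softInv δ ‖x - y‖ := fun y => softInv_nonneg (norm_nonneg _)
  have hc := continuous_softInv hδ
  rw [integral_eq_lintegral_of_nonneg_ae (.of_forall hnn) hint.1,
    ← ENNReal.toReal_add hint.lintegral_lt_top.ne hx, nearPotential,
    ← lintegral_add_left (by fun_prop), coulomb]
  congr 2 with y
  rw [← ENNReal.ofReal_add (hnn y) (sub_nonneg.mpr (softInv_le_inv (norm_nonneg _)))]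
  congr 1
  ring

theorem ae_nearPotential_ne_top (ν : Measure (EuclideanSpace ℝ (Fin 3)))
    [IsFiniteMeasure ν] {δ : ℝ} (hδ : 0 < δ) (hδ1 : δ ≤ 1) :
    ∀ᵐ x, nearPotential ν δ x ≠ ∞ := by
  have hfin : ∫⁻ x, nearPotential ν δ x ^ 2 ≠ ∞ := by
    refine ne_top_of_le_ne_top (ENNReal.mul_ne_top (ENNReal.pow_ne_top (measure_ne_top ν _)) ?_)
      (lintegral_nearPotential_sq_le ν hδ)
    exact ne_top_of_le_ne_top lintegral_ball_inv_norm_sq_ne_top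
      (lintegral_mono_set (Metric.ball_subset_ball hδ1))
  filter_upwards [ae_lt_top ((measurable_nearPotential ν hδ).pow_const 2) hfin] with x hx h
  simp [h] at hx

theorem lintegral_sq_coulomb_sub_le (ν μ : Measure (EuclideanSpace ℝ (Fin 3)))
    [IsFiniteMeasure ν] [IsFiniteMeasure μ] {δ : ℝ} (hδ : 0 < δ) (hδ1 : δ ≤ 1)
    (s : Set (EuclideanSpace ℝ (Fin 3))) :
    ∫⁻ x in s, ENNReal.ofReal (|coulomb ν x - coulomb μ x| ^ 2) ≤
      3 * (∫⁻ x in s, ENNReal.ofReal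
        ((∫ y, softInv δ ‖x - y‖ ∂ν - ∫ y, softInv δ ‖x - y‖ ∂μ) ^ 2)) +
      3 * (ν Set.univ ^ 2 + μ Set.univ ^ 2) *
        ∫⁻ z in Metric.ball (0 : EuclideanSpace ℝ (Fin 3)) δ, ENNReal.ofReal (‖z‖⁻¹ ^ 2) := by
  have hν := measurable_nearPotential ν hδ
  have hμ := measurable_nearPotential μ hδ
  calc ∫⁻ x in s, ENNReal.ofReal (|coulomb ν x - coulomb μ x| ^ 2)
      ≤ ∫⁻ x in s, 3 * (ENNReal.ofReal
          ((∫ y, softInv δ ‖x - y‖ ∂ν - ∫ y, softInv δ ‖x - y‖ ∂μ) ^ 2) +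
          (nearPotential ν δ x ^ 2 + nearPotential μ δ x ^ 2)) := by
        refine lintegral_mono_ae (ae_restrict_of_ae ?_)
        filter_upwards [ae_nearPotential_ne_top ν hδ hδ1, ae_nearPotential_ne_top μ hδ hδ1]
          with x hx hx'
        rw [coulomb_eq_add_nearPotential ν hδ hx, coulomb_eq_add_nearPotential μ hδ hx']
        lift nearPotential ν δ x to NNReal using hx with u
        lift nearPotential μ δ x to NNReal using hx' with v
        rw [ENNReal.coe_toReal, ENNReal.coe_toReal, ← ENNReal.ofReal_coe_nnreal,
          ← ENNReal.ofReal_coe_nnreal, ← ENNReal.ofReal_pow (by positivity),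
          ← ENNReal.ofReal_pow (by positivity),
          ← ENNReal.ofReal_add (by positivity) (by positivity),
          ← ENNReal.ofReal_add (by positivity) (by positivity),
          show (3 : ℝ≥0∞) = ENNReal.ofReal 3 by simp, ← ENNReal.ofReal_mul (by norm_num), sq_abs]
        generalize ∫ y, softInv δ ‖x - y‖ ∂ν = a, ∫ y, softInv δ ‖x - y‖ ∂μ = b
        refine ENNReal.ofReal_le_ofReal ?_
        nlinarith [sq_nonneg (a - b - u), sq_nonneg (a - b + v), sq_nonneg ((u : ℝ) + v)]
    _ = 3 * (∫⁻ x in s, ENNReal.ofReal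
          ((∫ y, softInv δ ‖x - y‖ ∂ν - ∫ y, softInv δ ‖x - y‖ ∂μ) ^ 2)) +
        3 * ((∫⁻ x in s, nearPotential ν δ x ^ 2) + ∫⁻ x in s, nearPotential μ δ x ^ 2) := by
        rw [lintegral_const_mul' _ _ (by simp), lintegral_add_right _ (by fun_prop),
          lintegral_add_right _ (by fun_prop), mul_add]
    _ ≤ _ := by
        rw [mul_assoc 3, add_mul]
        gcongr
        · exact (setLIntegral_le_lintegral _ _).trans (lintegral_nearPotential_sq_le ν hδ)
        · exact (setLIntegral_le_lintegral _ _).trans (lintegral_nearPotential_sq_le μ hδ)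

theorem measurable_integral_softInv (ν : Measure (EuclideanSpace ℝ (Fin 3)))
    [SFinite ν] {δ : ℝ} (hδ : 0 < δ) :
    Measurable fun x => ∫ y, softInv δ ‖x - y‖ ∂ν := by
  have := continuous_softInv hδ
  exact (StronglyMeasurable.integral_prod_right' (f := fun p : EuclideanSpace ℝ (Fin 3) ×
    EuclideanSpace ℝ (Fin 3) => softInv δ ‖p.1 - p.2‖)
      (by fun_prop : Continuous _).stronglyMeasurable).measurable

theorem norm_integral_softInv_le (ν : Measure (EuclideanSpace ℝ (Fin 3)))
    {C : NNReal} (hC : ν Set.univ ≤ C) {δ : ℝ} (hδ : 0 < δ)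
    (x : EuclideanSpace ℝ (Fin 3)) : ‖∫ y, softInv δ ‖x - y‖ ∂ν‖ ≤ δ⁻¹ * C := by
  have : IsFiniteMeasure ν := ⟨hC.trans_lt ENNReal.coe_lt_top⟩
  calc ‖∫ y, softInv δ ‖x - y‖ ∂ν‖ ≤ δ⁻¹ * ν.real Set.univ :=
        norm_integral_le_of_norm_le_const <| .of_forall fun y => by
          rw [Real.norm_of_nonneg (softInv_nonneg (norm_nonneg _))]
          exact softInv_le hδ _
    _ ≤ δ⁻¹ * C := by
        gcongr
        exact ENNReal.toReal_le_coe_of_le_coe hC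

theorem coulomb_tendsto_L2loc_of_vague
    (μn : ℕ → Measure (EuclideanSpace ℝ (Fin 3)))
    (μ : Measure (EuclideanSpace ℝ (Fin 3)))
    (hn : ∀ n, IsFiniteMeasure (μn n)) (hμ : IsFiniteMeasure μ)
    (hbound : ∃ C : NNReal, ∀ n, μn n Set.univ ≤ C)
    (hvague : ∀ f : EuclideanSpace ℝ (Fin 3) → ℝ, Continuous f →
      Tendsto f (cocompact _) (nhds 0) →
      Tendsto (fun n => ∫ x, f x ∂(μn n)) atTop (nhds (∫ x, f x ∂μ))) :
    ∀ R : ℝ, 0 < R →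
      Tendsto (fun n =>
          ∫ x in Metric.ball (0 : EuclideanSpace ℝ (Fin 3)) R,
            |coulomb (μn n) x - coulomb μ x| ^ 2)
        atTop (nhds 0) := by
  intro R _
  obtain ⟨C, hC⟩ : ∃ C : NNReal, (∀ n, μn n Set.univ ≤ C) ∧ μ Set.univ ≤ C := by
    obtain ⟨C, hC⟩ := hbound
    refine ⟨max C (μ Set.univ).toNNReal, fun n => (hC n).trans (by simp), ?_⟩
    rw [ENNReal.coe_max, ENNReal.coe_toNNReal (measure_ne_top μ _)]
    exact le_max_right _ _
  have hsoft : ∀ δ : ℝ, 0 < δ → Tendsto (fun n =>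
      ∫⁻ x in Metric.ball (0 : EuclideanSpace ℝ (Fin 3)) R, ENNReal.ofReal
        ((∫ y, softInv δ ‖x - y‖ ∂(μn n) - ∫ y, softInv δ ‖x - y‖ ∂μ) ^ 2)) atTop (𝓝 0) := by
    intro δ hδ
    have hlim : ∀ x : EuclideanSpace ℝ (Fin 3), Tendsto (fun n => ENNReal.ofReal
        ((∫ y, softInv δ ‖x - y‖ ∂(μn n) - ∫ y, softInv δ ‖x - y‖ ∂μ) ^ 2)) atTop (𝓝 0) := by
      intro x
      have hc := continuous_softInv hδ
      have h := hvague (fun y => softInv δ ‖x - y‖) (by fun_prop)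
        ((tendsto_softInv_atTop δ).comp (by
          simpa only [← dist_eq_norm] using tendsto_dist_left_cocompact_atTop x))
      simpa using ENNReal.tendsto_ofReal ((h.sub_const (∫ y, softInv δ ‖x - y‖ ∂μ)).pow 2)
    rw [← lintegral_zero
      (μ := volume.restrict (Metric.ball (0 : EuclideanSpace ℝ (Fin 3)) R))]
    refine tendsto_lintegral_of_dominated_convergence
      (fun _ => ENNReal.ofReal ((δ⁻¹ * C + δ⁻¹ * C) ^ 2)) (fun n => ?_)
      (fun n => .of_forall fun x => ENNReal.ofReal_le_ofReal ?_) ?_ (.of_forall hlim)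
    · exact (((measurable_integral_softInv (μn n) hδ).sub
        (measurable_integral_softInv μ hδ)).pow_const 2).ennreal_ofReal
    · rw [← sq_abs]
      gcongr
      exact norm_sub_le_of_le (norm_integral_softInv_le _ (hC.1 n) hδ x)
        (norm_integral_softInv_le _ hC.2 hδ x)
    · rw [lintegral_const]
      exact ENNReal.mul_ne_top ENNReal.ofReal_ne_top
        (by rw [Measure.restrict_apply_univ]; exact measure_ball_lt_top.ne)
  have hL : Tendsto (fun n => ∫⁻ x in Metric.ball (0 : EuclideanSpace ℝ (Fin 3)) R,
      ENNReal.ofReal (|coulomb (μn n) x - coulomb μ x| ^ 2)) atTop (𝓝 0) := by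
    rw [ENNReal.tendsto_nhds_zero]
    intro ε hε
    have hε2 : 0 < ε / 2 := ENNReal.half_pos hε.ne'
    have htail := ENNReal.Tendsto.const_mul (a := 3 * ((C : ℝ≥0∞) ^ 2 + (C : ℝ≥0∞) ^ 2))
      tendsto_lintegral_ball_inv_norm_sq (Or.inr (by finiteness))
    rw [mul_zero, ENNReal.tendsto_nhds_zero] at htail
    obtain ⟨δ, hδε, hδ⟩ := ((htail _ hε2).and (Ioo_mem_nhdsGT one_pos)).exists
    have hmain := ENNReal.Tendsto.const_mul (a := 3) (hsoft δ hδ.1) (Or.inr (by simp))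
    rw [mul_zero, ENNReal.tendsto_nhds_zero] at hmain
    filter_upwards [hmain _ hε2] with n hnε
    refine (lintegral_sq_coulomb_sub_le (μn n) μ hδ.1 hδ.2.le _).trans ?_
    rw [← ENNReal.add_halves ε]
    refine add_le_add hnε (le_trans ?_ hδε)
    gcongr
    · exact hC.1 n
    · exact hC.2
  have hreal := (ENNReal.tendsto_toReal ENNReal.zero_ne_top).comp hL
  refine hreal.congr fun n => ?_
  have hm := (measurable_coulomb (μn n)).sub (measurable_coulomb μ)
  refine (integral_eq_lintegral_of_nonneg_ae (.of_forall fun x => by positivity) ?_).symm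
  exact (hm.norm.pow_const 2).aestronglyMeasurable
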